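/- Let Q₁ be the conjunctive query H(x,x) ← R(x,x) and Q₂ the conjunctive query H(y,z) ← R(y,z), S(y,z), and let Q = Q₁ ∪ Q₂. Let ρ be the distribution policy over the network {κ₁, κ₂} with universe dom that makes κ₁ responsible exactly for the facts R(a,a) for all a ∈ dom, and κ₂ responsible exactly for all facts R(a,b) with a ≠ b and all facts S(a,b). Then (i) Q is parallel-correct under ρ, and (ii) Q₂ is not parallel-complete under ρ; in particular Q₂ is not parallel-complete on the instance I = {R(0,0), S(0,0)} under ρ. -/

import Mathlib

/-- An atom `R(x₁,…,x_k)`: a relation name together with a tuple of variables. -/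
structure Atom (R V : Type) where
  rel : R
  args : List V
deriving DecidableEq

/-- A fact `R(t)`: a relation name together with a tuple of data values. -/
structure DBFact (R D : Type) where
  rel : R
  args : List D
deriving DecidableEq

/-- Applying a valuation to an atom yields a fact. -/
def Atom.app {R V D : Type} (f : V → D) (a : Atom R V) : DBFact R D :=
  ⟨a.rel, a.args.map f⟩

/-- The variables occurring in an atom. -/
def Atom.vars {R V : Type} (a : Atom R V) : Set V := {v | v ∈ a.args}

/-- A conjunctive query with negation and inequalities (CQ¬,≠): a head atom,
finite sets of positive and negated body atoms, and a finite set of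
inequalities between variables. -/
structure CQ (R V : Type) where
  head : Atom R V
  pos : Finset (Atom R V)
  neg : Finset (Atom R V)
  ineq : Finset (V × V)

namespace CQ

variable {R V D : Type}

/-- The variables occurring in a query. -/
def vars (Q : CQ R V) : Set V :=
  Q.head.vars ∪ (⋃ a ∈ (↑Q.pos : Set (Atom R V)), a.vars) ∪
    (⋃ a ∈ (↑Q.neg : Set (Atom R V)), a.vars) ∪
    (⋃ p ∈ (↑Q.ineq : Set (V × V)), {p.1, p.2})

/-- Safety: every head variable and every variable of a negated atom occurs in
some positive atom. -/
def safe (Q : CQ R V) : Prop :=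
  (∀ v ∈ Q.head.vars, ∃ a ∈ Q.pos, v ∈ a.args) ∧
  (∀ a ∈ Q.neg, ∀ v ∈ a.args, ∃ b ∈ Q.pos, v ∈ b.args)

/-- A query is full if every one of its variables occurs in its head atom. -/
def isFull (Q : CQ R V) : Prop := ∀ v ∈ Q.vars, v ∈ Q.head.args

/-- The facts required by a valuation `f`: `f(pos(Q))`. -/
def posFacts (Q : CQ R V) (f : V → D) : Set (DBFact R D) :=
  Atom.app f '' (↑Q.pos : Set (Atom R V))

/-- The facts prohibited by a valuation `f`: `f(neg(Q))`. -/
def negFacts (Q : CQ R V) (f : V → D) : Set (DBFact R D) :=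
  Atom.app f '' (↑Q.neg : Set (Atom R V))

/-- `f` is a valuation for `Q`: required and prohibited facts are disjoint and
all inequalities are respected. -/
def isVal (Q : CQ R V) (f : V → D) : Prop :=
  Q.posFacts f ∩ Q.negFacts f = ∅ ∧
  ∀ p ∈ Q.ineq, f p.1 ≠ f p.2

/-- `f` satisfies `Q` on `I`: all required facts are in `I` and no prohibited
fact is in `I`. -/
def sat (Q : CQ R V) (f : V → D) (I : Set (DBFact R D)) : Prop :=
  Q.posFacts f ⊆ I ∧ Q.negFacts f ∩ I = ∅

/-- `Q(I)`: the set of facts derived on `I` by valuations satisfying `Q`. -/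
def eval (Q : CQ R V) (I : Set (DBFact R D)) : Set (DBFact R D) :=
  {fc | ∃ f : V → D, Q.isVal f ∧ Q.sat f I ∧ Atom.app f Q.head = fc}

end CQ

/-- A union of conjunctive queries (with negation and inequalities): a finite,
nonempty family of CQ¬,≠s. -/
structure UCQ (R V : Type) where
  n : ℕ
  npos : 0 < n
  disj : Fin n → CQ R V

namespace UCQ

variable {R V D : Type}

/-- Well-formedness of a UCQ: every disjunct is safe, all disjuncts have the
same head relation, and distinct disjuncts have disjoint variable sets. -/
def wf (Q : UCQ R V) : Prop :=
  (∀ i, (Q.disj i).safe) ∧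
  (∀ i j, (Q.disj i).head.rel = (Q.disj j).head.rel) ∧
  (∀ i j, i ≠ j → Disjoint (Q.disj i).vars (Q.disj j).vars)

/-- `Q(I) = ⋃ᵢ Qᵢ(I)`. -/
def eval (Q : UCQ R V) (I : Set (DBFact R D)) : Set (DBFact R D) :=
  ⋃ i, (Q.disj i).eval I

/-- The maximum number of variables of any disjunct. -/
noncomputable def varmax (Q : UCQ R V) : ℕ :=
  Finset.univ.sup fun i => ((Q.disj i).vars).ncard

end UCQ

/-- The values of the fact all belong to `U`. -/
def DBFact.valsIn {R D : Type} (fc : DBFact R D) (U : Set D) : Prop :=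
  ∀ d ∈ fc.args, d ∈ U

/-- The active domain of an instance: all data values occurring in it. -/
def adom {R D : Type} (I : Set (DBFact R D)) : Set D :=
  {d | ∃ fc ∈ I, d ∈ fc.args}

/-- A distribution policy over network (node type) `K`: a universe `U` of data
values and, for each node, the set of facts (with values from `U`) it is
responsible for. -/
structure Policy (R D K : Type) where
  U : Set D
  rfacts : K → Set (DBFact R D)
  rfacts_vals : ∀ κ, ∀ fc ∈ rfacts κ, fc.valsIn U

namespace Policy
variable {R D K : Type}
/-- The local instance at node `κ`. -/
def dist (ρ : Policy R D K) (I : Set (DBFact R D)) (κ : K) : Set (DBFact R D) :=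
  I ∩ ρ.rfacts κ
end Policy

/-- `I` is an instance (finite set of facts) with values from `U`. -/
def instOver {R D : Type} (I : Set (DBFact R D)) (U : Set D) : Prop :=
  I.Finite ∧ ∀ fc ∈ I, fc.valsIn U

section Parallel
variable {R D K : Type}

/-- `q` is parallel-sound on `I` under `ρ`. -/
def parSoundOn (q : Set (DBFact R D) → Set (DBFact R D)) (ρ : Policy R D K)
    (I : Set (DBFact R D)) : Prop :=
  (⋃ κ : K, q (ρ.dist I κ)) ⊆ q I

/-- `q` is parallel-complete on `I` under `ρ`. -/
def parCompleteOn (q : Set (DBFact R D) → Set (DBFact R D)) (ρ : Policy R D K)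
    (I : Set (DBFact R D)) : Prop :=
  q I ⊆ ⋃ κ : K, q (ρ.dist I κ)

/-- `q` is parallel-correct on `I` under `ρ`. -/
def parCorrectOn (q : Set (DBFact R D) → Set (DBFact R D)) (ρ : Policy R D K)
    (I : Set (DBFact R D)) : Prop :=
  q I = ⋃ κ : K, q (ρ.dist I κ)

/-- `q` is parallel-sound under `ρ`: sound on every instance with values from
the universe of `ρ`. -/
def parSound (q : Set (DBFact R D) → Set (DBFact R D)) (ρ : Policy R D K) : Prop :=
  ∀ I : Set (DBFact R D), instOver I ρ.U → parSoundOn q ρ I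

/-- `q` is parallel-complete under `ρ`. -/
def parComplete (q : Set (DBFact R D) → Set (DBFact R D)) (ρ : Policy R D K) : Prop :=
  ∀ I : Set (DBFact R D), instOver I ρ.U → parCompleteOn q ρ I

/-- `q` is parallel-correct under `ρ`. -/
def parCorrect (q : Set (DBFact R D) → Set (DBFact R D)) (ρ : Policy R D K) : Prop :=
  ∀ I : Set (DBFact R D), instOver I ρ.U → parCorrectOn q ρ I

end Parallel

/-- The schema of the example: relations `H`, `R`, `S` (all binary). -/
inductive Rel10 | H | R | S
deriving DecidableEq

/-- The variables `x = 0`, `y = 1`, `z = 2` (as natural numbers); data values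
are natural numbers. -/
abbrev Var10 := ℕ

/-- `Q₁ : H(x,x) ← R(x,x)`. -/
def ex10Q1 : CQ Rel10 Var10 :=
  ⟨⟨Rel10.H, [0, 0]⟩, {⟨Rel10.R, [0, 0]⟩}, ∅, ∅⟩

/-- `Q₂ : H(y,z) ← R(y,z), S(y,z)`. -/
def ex10Q2 : CQ Rel10 Var10 :=
  ⟨⟨Rel10.H, [1, 2]⟩, {⟨Rel10.R, [1, 2]⟩, ⟨Rel10.S, [1, 2]⟩}, ∅, ∅⟩

/-- `Q = Q₁ ∪ Q₂`. -/
def ex10Q : UCQ Rel10 Var10 := ⟨2, by norm_num, ![ex10Q1, ex10Q2]⟩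

/-- The policy over the two-node network `{κ₁, κ₂}` (encoded as `true` = κ₁,
`false` = κ₂) with universe `dom = ℕ`: κ₁ is responsible exactly for the facts
`R(a,a)`, and κ₂ for all facts `R(a,b)` with `a ≠ b` and all facts `S(a,b)`. -/
def ex10ρ : Policy Rel10 ℕ Bool where
  U := Set.univ
  rfacts := fun κ =>
    match κ with
    | true => {fc | ∃ a : ℕ, fc = ⟨Rel10.R, [a, a]⟩}
    | false => {fc | (∃ a b : ℕ, a ≠ b ∧ fc = ⟨Rel10.R, [a, b]⟩) ∨
                     (∃ a b : ℕ, fc = ⟨Rel10.S, [a, b]⟩)}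
  rfacts_vals := by
    intro κ fc _
    intro d _
    exact Set.mem_univ d

theorem ex10Q1_mem_eval {D : Type} (I : Set (DBFact Rel10 D)) (fc : DBFact Rel10 D) :
    fc ∈ ex10Q1.eval I ↔ ∃ a : D, ⟨Rel10.R, [a, a]⟩ ∈ I ∧ ⟨Rel10.H, [a, a]⟩ = fc := by
  constructor
  · rintro ⟨f, -, ⟨hpos, -⟩, rfl⟩
    exact ⟨f 0, hpos ⟨⟨Rel10.R, [0, 0]⟩, by simp [ex10Q1], rfl⟩, rfl⟩
  · rintro ⟨a, ha, rfl⟩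
    refine ⟨fun _ => a, ?_, ?_, rfl⟩
    · simp [CQ.isVal, CQ.negFacts, ex10Q1]
    · simpa [CQ.sat, CQ.posFacts, CQ.negFacts, ex10Q1, Atom.app] using ha

theorem ex10Q2_mem_eval {D : Type} (I : Set (DBFact Rel10 D)) (fc : DBFact Rel10 D) :
    fc ∈ ex10Q2.eval I ↔ ∃ a b : D, ⟨Rel10.R, [a, b]⟩ ∈ I ∧ ⟨Rel10.S, [a, b]⟩ ∈ I ∧
      ⟨Rel10.H, [a, b]⟩ = fc := by
  constructor
  · rintro ⟨f, -, ⟨hpos, -⟩, rfl⟩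
    exact ⟨f 1, f 2, hpos ⟨⟨Rel10.R, [1, 2]⟩, by simp [ex10Q2], rfl⟩,
      hpos ⟨⟨Rel10.S, [1, 2]⟩, by simp [ex10Q2], rfl⟩, rfl⟩
  · rintro ⟨a, b, hR, hS, rfl⟩
    refine ⟨fun n => if n = 1 then a else b, ?_, ?_, rfl⟩
    · simp [CQ.isVal, CQ.negFacts, ex10Q2]
    · simp [CQ.sat, CQ.posFacts, CQ.negFacts, ex10Q2, Atom.app, Set.insert_subset_iff,
        Set.image_insert_eq, hR, hS]

theorem ex10Q_mem_eval {I : Set (DBFact Rel10 ℕ)} {fc : DBFact Rel10 ℕ} :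
    fc ∈ ex10Q.eval I ↔ fc ∈ ex10Q1.eval I ∨ fc ∈ ex10Q2.eval I := by
  change fc ∈ (⋃ i : Fin 2, (![ex10Q1, ex10Q2] i).eval I) ↔ _
  simp [Fin.exists_fin_two]

theorem ex10Q_eval_mono {I J : Set (DBFact Rel10 ℕ)} (h : I ⊆ J) :
    ex10Q.eval I ⊆ ex10Q.eval J := by
  intro fc
  simp only [ex10Q_mem_eval, ex10Q1_mem_eval, ex10Q2_mem_eval]
  rintro (⟨a, ha, rfl⟩ | ⟨a, b, hR, hS, rfl⟩)
  · exact Or.inl ⟨a, h ha, rfl⟩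
  · exact Or.inr ⟨a, b, h hR, h hS, rfl⟩

theorem ex10Q_parCorrect : parCorrect (fun I => ex10Q.eval I) ex10ρ := by
  intro I _
  refine Set.Subset.antisymm (fun fc hfc => ?_)
    (Set.iUnion_subset fun κ => ex10Q_eval_mono Set.inter_subset_left)
  have diag (a : ℕ) (ha : ⟨Rel10.R, [a, a]⟩ ∈ I) :
      ⟨Rel10.H, [a, a]⟩ ∈ ⋃ κ, ex10Q.eval (ex10ρ.dist I κ) :=
    Set.mem_iUnion.2 ⟨true, ex10Q_mem_eval.2 (Or.inl ((ex10Q1_mem_eval _ _).2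
      ⟨a, ⟨ha, a, rfl⟩, rfl⟩))⟩
  rcases ex10Q_mem_eval.1 hfc with h | h
  · obtain ⟨a, ha, rfl⟩ := (ex10Q1_mem_eval _ _).1 h
    exact diag a ha
  · obtain ⟨a, b, hR, hS, rfl⟩ := (ex10Q2_mem_eval _ _).1 h
    by_cases hab : a = b
    · subst hab
      exact diag a hR
    · exact Set.mem_iUnion.2 ⟨false, ex10Q_mem_eval.2 (Or.inr ((ex10Q2_mem_eval _ _).2
        ⟨a, b, ⟨hR, Or.inl ⟨a, b, hab, rfl⟩⟩, ⟨hS, Or.inr ⟨a, b, rfl⟩⟩, rfl⟩))⟩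

theorem ex10Q2_not_parCompleteOn :
    ¬ parCompleteOn (fun I => ex10Q2.eval I) ex10ρ
        {⟨Rel10.R, [0, 0]⟩, ⟨Rel10.S, [0, 0]⟩} := by
  intro h
  have hmem := h ((ex10Q2_mem_eval _ ⟨Rel10.H, [0, 0]⟩).2 ⟨0, 0, by simp, by simp, rfl⟩)
  obtain ⟨κ, hκ⟩ := Set.mem_iUnion.1 hmem
  obtain ⟨a, b, ⟨-, hR⟩, ⟨-, hS⟩, hH⟩ := (ex10Q2_mem_eval _ _).1 hκ
  obtain ⟨rfl, rfl⟩ : a = 0 ∧ b = 0 := by simpa using hH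
  cases κ
  · rcases hR with ⟨a, b, hab, heq⟩ | ⟨a, b, heq⟩
    · simp only [DBFact.mk.injEq, List.cons.injEq] at heq
      exact hab (heq.2.1.symm.trans heq.2.2.1)
    · simp at heq
  · obtain ⟨a, heq⟩ := hS
    simp at heq

/-- (i) `Q = Q₁ ∪ Q₂` is parallel-correct under `ρ`;
(ii) `Q₂` is not parallel-complete under `ρ`, and in particular `Q₂` is not
parallel-complete on `I = {R(0,0), S(0,0)}` under `ρ`. -/
theorem ex10_parallel_correct_and_incomplete_disjunct :
    parCorrect (fun I => ex10Q.eval I) ex10ρ ∧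
    ¬ parComplete (fun I => ex10Q2.eval I) ex10ρ ∧
    ¬ parCompleteOn (fun I => ex10Q2.eval I) ex10ρ
        {⟨Rel10.R, [0, 0]⟩, ⟨Rel10.S, [0, 0]⟩} := by
  refine ⟨ex10Q_parCorrect, fun h => ex10Q2_not_parCompleteOn (h _ ⟨?_, ?_⟩),
    ex10Q2_not_parCompleteOn⟩
  · exact Set.toFinite _
  · exact fun _ _ _ _ => Set.mem_univ _
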